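/- arXiv:0812.3899 — 4 statements merged into one kernel-verified Lean document; each statement's English description precedes it below -/
import Mathlib

section
/- For the Model-I network map F: if two states V, V' ∈ ℝ^N have the same spiking pattern, i.e. Z(V_i) = Z(V'_i) for every i, then ‖F(V) − F(V')‖ ≤ ρ·‖V − V'‖ in the sup norm. In particular, F is a ρ-contraction on each element of the natural partition of phase space into spiking patterns. -/
/-- Model I: if two states have the same spiking pattern, the network map `F`
contracts their distance by a factor `ρ` in the sup norm. -/
theorem modelI_contraction_on_partition_element
    (N : ℕ) (hN : 1 ≤ N) (θ ρ : ℝ) (hθ : 0 < θ) (hρ0 : 0 ≤ ρ) (hρ1 : ρ < 1)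
    (W : Fin N → Fin N → ℝ) (I : Fin N → ℝ)
    (Z : ℝ → ℝ) (hZ : ∀ x, Z x = if θ ≤ x then 1 else 0)
    (F : (Fin N → ℝ) → (Fin N → ℝ))
    (hF : ∀ V i, F V i = ρ * V i * (1 - Z (V i)) + (∑ j, W i j * Z (V j)) + I i)
    (V V' : Fin N → ℝ) (hpat : ∀ i, Z (V i) = Z (V' i)) :
    ‖F V - F V'‖ ≤ ρ * ‖V - V'‖ := by
  have hnn : 0 ≤ ρ * ‖V - V'‖ := mul_nonneg hρ0 (norm_nonneg _)
  refine (pi_norm_le_iff_of_nonneg hnn).2 fun i => ?_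
  have hsum : (∑ j, W i j * Z (V j)) = ∑ j, W i j * Z (V' j) :=
    Finset.sum_congr rfl fun j _ => by rw [hpat j]
  have key : (F V - F V') i = ρ * (V - V') i * (1 - Z (V' i)) := by
    rw [Pi.sub_apply, Pi.sub_apply, hF, hF, hsum, hpat i]
    ring
  have hi : ‖(V - V') i‖ ≤ ‖V - V'‖ := norm_le_pi_norm (V - V') i
  rw [key, hZ]
  split_ifs
  · simpa using hnn
  · rw [sub_zero, mul_one, norm_mul, Real.norm_of_nonneg hρ0]
    exact mul_le_mul_of_nonneg_left hi hρ0
end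

section
/- For the Model-I network map F: if V, V' ∈ ℝ^N are such that for every 0 ≤ t < n the iterates F^t(V) and F^t(V') have the same spiking pattern, then ‖F^n(V) − F^n(V')‖ ≤ ρ^n·‖V − V'‖ in the sup norm. Consequently, two orbits generating the same raster plot for n consecutive steps approach each other exponentially fast in n. -/
/-- Model I: if two orbits generate the same raster plot (same spiking patterns)
for `n` consecutive steps, then they approach each other exponentially fast:
`‖F^[n] V − F^[n] V'‖ ≤ ρ^n · ‖V − V'‖` in the sup norm. -/
theorem modelI_same_raster_exponential_contraction
    (N : ℕ) (hN : 1 ≤ N) (θ ρ : ℝ) (hθ : 0 < θ) (hρ0 : 0 ≤ ρ) (hρ1 : ρ < 1)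
    (W : Fin N → Fin N → ℝ) (I : Fin N → ℝ)
    (Z : ℝ → ℝ) (hZ : ∀ x, Z x = if θ ≤ x then 1 else 0)
    (F : (Fin N → ℝ) → (Fin N → ℝ))
    (hF : ∀ V i, F V i = ρ * V i * (1 - Z (V i)) + (∑ j, W i j * Z (V j)) + I i)
    (n : ℕ) (V V' : Fin N → ℝ)
    (hpat : ∀ t < n, ∀ i, Z ((F^[t] V) i) = Z ((F^[t] V') i)) :
    ‖F^[n] V - F^[n] V'‖ ≤ ρ ^ n * ‖V - V'‖ := by
  have step : ∀ A B : Fin N → ℝ, (∀ i, Z (A i) = Z (B i)) →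
      ‖F A - F B‖ ≤ ρ * ‖A - B‖ := by
    intro A B h
    rw [pi_norm_le_iff_of_nonneg (by positivity)]
    intro i
    have e : (F A - F B) i = ρ * (1 - Z (B i)) * ((A - B) i) := by
      simp only [Pi.sub_apply, hF, h]
      ring
    have hb : ‖(A - B) i‖ ≤ ‖A - B‖ := norm_le_pi_norm _ i
    rw [e, hZ]
    split_ifs
    · simp only [sub_self, mul_zero, zero_mul, norm_zero]
      positivity
    · rw [sub_zero, mul_one, norm_mul, Real.norm_of_nonneg hρ0]
      exact mul_le_mul_of_nonneg_left hb hρ0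
  induction n with
  | zero => simp
  | succ k ih =>
    rw [Function.iterate_succ_apply', Function.iterate_succ_apply']
    have h1 := step _ _ (hpat k (Nat.lt_succ_self k))
    have h2 := ih (fun t ht => hpat t (Nat.lt_succ_of_lt ht))
    calc _ ≤ _ := h1
      _ ≤ ρ * (ρ ^ k * ‖V - V'‖) := mul_le_mul_of_nonneg_left h2 hρ0
      _ = _ := by ring
end

section
/- (Genericity theorem, item 1.) Let M ⊂ ℝ^N be a nonempty compact set with F(M) ⊆ M for the Model-I map F, and let Ω = ⋂_{t ≥ 0} F^t(M) be the attracting (ω-limit) set. Assume there exists δ > 0 such that every orbit in Ω stays at distance at least δ from the singularity set: for all V ∈ Ω, all t ≥ 0 and all i, |(F^t(V))_i − θ| ≥ δ. Then Ω is a finite set and every point of Ω is periodic: for each V ∈ Ω there exists p ≥ 1 with F^p(V) = V. In particular the asymptotic dynamics consists of finitely many periodic orbits with finite period. -/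
namespace ModelI

/-- The firing set of a state. -/
noncomputable def pat {N : ℕ} (θ : ℝ) (V : Fin N → ℝ) : Finset (Fin N) :=
  Finset.univ.filter (fun i => θ ≤ V i)

lemma mem_pat {N : ℕ} {θ : ℝ} {V : Fin N → ℝ} {i : Fin N} : i ∈ pat θ V ↔ θ ≤ V i := by
  simp [pat]

/-- A firing neuron is reset; a silent one evolves affinely, with a common drive. -/
def IsNet {N : ℕ} (θ ρ : ℝ) (c : Fin N → Finset (Fin N) → ℝ)
    (F : (Fin N → ℝ) → (Fin N → ℝ)) : Prop :=
  ∀ V i, F V i = (if i ∈ pat θ V then 0 else ρ * V i) + c i (pat θ V)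

section
variable {N : ℕ} {θ ρ : ℝ} {c : Fin N → Finset (Fin N) → ℝ} {F : (Fin N → ℝ) → (Fin N → ℝ)}

lemma fired_determined (h : IsNet θ ρ c F) (U U' : Fin N → ℝ) (i : Fin N) (m : ℕ)
    (hp : ∀ j < m, pat θ (F^[j] U) = pat θ (F^[j] U'))
    (hk : ∃ k < m, i ∈ pat θ (F^[k] U)) : (F^[m] U) i = (F^[m] U') i := by
  induction m with
  | zero => obtain ⟨k, hk, _⟩ := hk; omega
  | succ m ih =>
    rw [Function.iterate_succ_apply', Function.iterate_succ_apply', h, h,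
      ← hp m (by omega)]
    by_cases hm : i ∈ pat θ (F^[m] U)
    · simp [hm]
    · obtain ⟨k, hk, hki⟩ := hk
      have hkm : k ≠ m := by rintro rfl; exact hm hki
      rw [ih (fun j hj => hp j (by omega)) ⟨k, by omega, hki⟩]

lemma contraction (h : IsNet θ ρ c F) (hρ0 : 0 ≤ ρ) (U U' : Fin N → ℝ) (i : Fin N) (m : ℕ)
    (hp : ∀ j < m, pat θ (F^[j] U) = pat θ (F^[j] U')) :
    |(F^[m] U) i - (F^[m] U') i| ≤ ρ ^ m * |U i - U' i| := by
  induction m with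
  | zero => simp
  | succ m ih =>
    have ih := ih (fun j hj => hp j (by omega))
    rw [Function.iterate_succ_apply', Function.iterate_succ_apply', h, h,
      ← hp m (by omega)]
    have h0 : 0 ≤ ρ ^ (m+1) * |U i - U' i| := by positivity
    split_ifs
    · simpa using h0
    · have : ρ * (F^[m] U) i + c i (pat θ (F^[m] U)) - (ρ * (F^[m] U') i + c i (pat θ (F^[m] U)))
        = ρ * ((F^[m] U) i - (F^[m] U') i) := by ring
      rw [this, abs_mul, abs_of_nonneg hρ0, pow_succ', mul_assoc]
      gcongr

lemma silent_formula (h : IsNet θ ρ c F) (U : Fin N → ℝ) (i : Fin N) (m : ℕ)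
    (hs : ∀ k < m, i ∉ pat θ (F^[k] U)) :
    (F^[m] U) i = ρ ^ m * U i
      + ∑ k ∈ Finset.range m, ρ ^ (m - 1 - k) * c i (pat θ (F^[k] U)) := by
  induction m with
  | zero => simp
  | succ m ih =>
    rw [Function.iterate_succ_apply', h, if_neg (hs m (by omega)),
      ih (fun k hk => hs k (by omega)), Finset.sum_range_succ, mul_add, Finset.mul_sum]
    have : ∑ k ∈ Finset.range m, ρ * (ρ ^ (m - 1 - k) * c i (pat θ (F^[k] U)))
        = ∑ k ∈ Finset.range m, ρ ^ (m + 1 - 1 - k) * c i (pat θ (F^[k] U)) := by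
      apply Finset.sum_congr rfl
      intro k hk
      have hk := Finset.mem_range.1 hk
      rw [show m + 1 - 1 - k = (m - 1 - k) + 1 by omega, pow_succ]
      ring
    rw [this]
    simp
    ring

lemma silent_diff (h : IsNet θ ρ c F) (U : Fin N → ℝ) (i : Fin N) (p s : ℕ)
    (hs : ∀ k < s, i ∉ pat θ (F^[k] U))
    (hper : ∀ k, k + p < s → pat θ (F^[k + p] U) = pat θ (F^[k] U)) (t : ℕ) (ht : t + p ≤ s) :
    (F^[t + p] U) i - (F^[t] U) i = ρ ^ t * ((F^[p] U) i - U i) := by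
  induction t with
  | zero => simp
  | succ t ih =>
    have ih := ih (by omega)
    rw [show t + 1 + p = (t + p) + 1 by omega, Function.iterate_succ_apply',
      Function.iterate_succ_apply', h, h, hper t (by omega),
      if_neg (hs t (by omega)), if_neg (hs t (by omega)), pow_succ', mul_assoc, ← ih]
    ring

lemma escape (h : IsNet θ ρ c F) (hρ0 : 0 ≤ ρ) (hρ1 : ρ < 1) (M : Set (Fin N → ℝ))
    (hFM : ∀ V ∈ M, F V ∈ M) (R : ℝ) (hR : ∀ V ∈ M, ∀ i, |V i| ≤ R) (p : ℕ) (hp : 1 ≤ p) :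
    ∃ T : ℕ, ∀ i, ∀ U ∈ M, ∀ s, T ≤ s → (∀ k < s, i ∉ pat θ (F^[k] U)) →
      (∀ k, k + p < s → pat θ (F^[k + p] U) = pat θ (F^[k] U)) → i ∉ pat θ (F^[s] U) := by
  have hq1 : ρ ^ p < 1 := pow_lt_one₀ hρ0 hρ1 (by omega)
  let b : Fin N × (Fin p → Finset (Fin N)) → ℝ :=
    fun x => ∑ k : Fin p, ρ ^ (p - 1 - (k : ℕ)) * c x.1 (x.2 k)
  have hg : ∀ᶠ g : ℝ in nhdsWithin 0 (Set.Ioi 0), ∀ x, (1 - ρ ^ p) * θ < b x →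
      (1 - ρ ^ p) * θ + g ≤ b x := by
    rw [Filter.eventually_all]
    intro x
    by_cases hx : (1 - ρ ^ p) * θ < b x
    · have : ∀ᶠ g : ℝ in nhdsWithin 0 (Set.Ioi 0), g < b x - (1 - ρ ^ p) * θ :=
        nhdsWithin_le_nhds (Iio_mem_nhds (by linarith))
      filter_upwards [this] with g hg _
      linarith
    · filter_upwards with g hg
      exact absurd hg hx
  obtain ⟨g, hg, hg0⟩ := (hg.and self_mem_nhdsWithin).exists
  have hg0 : 0 < g := hg0
  have htend : Filter.Tendsto (fun n : ℕ => ρ ^ n * (2 * R)) Filter.atTop (nhds 0) := by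
    simpa using (tendsto_pow_atTop_nhds_zero_of_lt_one hρ0 hρ1).mul_const (2 * R)
  obtain ⟨n0, hn0⟩ := Filter.eventually_atTop.1 (htend.eventually (Iio_mem_nhds hg0))
  refine ⟨n0 + p + 1, ?_⟩
  intro i U hU s hs hsil hper hfire
  have hinv : ∀ t, F^[t] U ∈ M := by
    intro t
    induction t with
    | zero => exact hU
    | succ t ih => rw [Function.iterate_succ_apply']; exact hFM _ ih
  have hd := silent_diff h U i p s hsil hper (s - p) (by omega)
  rw [show s - p + p = s by omega] at hd
  have hform := silent_formula h (F^[s - p] U) i p (fun k hk => by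
    rw [← Function.iterate_add_apply]; exact hsil _ (by omega))
  rw [← Function.iterate_add_apply, show p + (s - p) = s by omega, Finset.sum_range] at hform
  have hb := hg (i, fun k : Fin p => pat θ (F^[(k : ℕ)] (F^[s - p] U)))
  change (F^[s] U) i = ρ ^ p * (F^[s - p] U) i
    + b (i, fun k : Fin p => pat θ (F^[(k : ℕ)] (F^[s - p] U))) at hform
  generalize b (i, fun k : Fin p => pat θ (F^[(k : ℕ)] (F^[s - p] U))) = B at hb hform
  have hfire := mem_pat.1 hfire
  have hprev : (F^[s - p] U) i < θ := by
    have := hsil (s - p) (by omega)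
    rw [mem_pat] at this
    linarith
  have hρ : 0 < ρ := by
    rcases hρ0.lt_or_eq with h' | h'
    · exact h'
    · rw [← h', zero_pow (by omega)] at hd
      linarith
  have hqpos : 0 < ρ ^ p := by positivity
  have h1 := abs_le.1 (hR _ (hinv p) i)
  have h2 := abs_le.1 (hR _ hU i)
  have h3 : (F^[s] U) i - (F^[s - p] U) i ≤ ρ ^ (s - p) * (2 * R) := by
    rw [hd]
    gcongr
    linarith [h1.2, h2.1]
  have h4 : ρ ^ (s - p) * (2 * R) < g := hn0 (s - p) (by omega)
  generalize (F^[s] U) i = x at *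
  generalize (F^[s - p] U) i = y at *
  have h5 : (1 - ρ ^ p) * θ < B := by nlinarith
  have h6 := hb h5
  nlinarith

/-- Orbits in `M` along which neurons outside `A` are silent have eventually periodic patterns. -/
def Per (θ : ℝ) (F : (Fin N → ℝ) → (Fin N → ℝ)) (M : Set (Fin N → ℝ)) (A : Finset (Fin N))
    (n : ℕ) : Prop :=
  ∀ V ∈ M, ∀ L, (∀ t < L, ∀ i, i ∉ A → i ∉ pat θ (F^[t] V)) →
    ∀ t, n ≤ t → t + n.factorial < L → pat θ (F^[t + n.factorial] V) = pat θ (F^[t] V)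

lemma iter_period {α : Type*} (f : ℕ → α) (a d L : ℕ)
    (hf : ∀ t, a ≤ t → t + d < L → f (t + d) = f t) (m : ℕ) :
    ∀ t, a ≤ t → t + d * m < L → f (t + d * m) = f t := by
  induction m with
  | zero => simp
  | succ m ih =>
    intro t ht hL
    rw [Nat.mul_succ] at hL ⊢
    rw [← Nat.add_assoc, hf _ (by omega) (by omega), ih t ht (by omega)]

lemma Per.mono {M : Set (Fin N → ℝ)} {A : Finset (Fin N)} {n m : ℕ} (h : Per θ F M A n)
    (hnm : n ≤ m) : Per θ F M A m := by
  intro V hV L hL t ht htL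
  obtain ⟨k, hk⟩ := Nat.factorial_dvd_factorial hnm
  rw [hk] at htL ⊢
  exact iter_period (fun t => pat θ (F^[t] V)) n _ L (h V hV L hL) k t (by omega) htL

lemma per_all (h : IsNet θ ρ c F) (hρ0 : 0 ≤ ρ) (hρ1 : ρ < 1) (M : Set (Fin N → ℝ))
    (hFM : ∀ V ∈ M, F V ∈ M) (R : ℝ) (hR : ∀ V ∈ M, ∀ i, |V i| ≤ R) (A : Finset (Fin N)) :
    ∃ n, Per θ F M A n := by
  classical
  have hinv : ∀ U ∈ M, ∀ t, F^[t] U ∈ M := by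
    intro U hU t
    induction t with
    | zero => exact hU
    | succ t ih => rw [Function.iterate_succ_apply']; exact hFM _ ih
  induction A using Finset.strongInduction with
  | H A ih =>
  have ih' : ∀ i : Fin N, ∃ n, i ∈ A → Per θ F M (A.erase i) n := by
    intro i
    by_cases hi : i ∈ A
    · obtain ⟨n, hn⟩ := ih _ (Finset.erase_ssubset hi)
      exact ⟨n, fun _ => hn⟩
    · exact ⟨0, fun h => absurd h hi⟩
  choose nn hnn using ih'
  obtain ⟨n, hn⟩ : ∃ n, ∀ i ∈ A, Per θ F M (A.erase i) n :=
    ⟨Finset.univ.sup nn, fun i hi => (hnn i hi).mono (Finset.le_sup (Finset.mem_univ i))⟩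
  obtain ⟨T', hT'⟩ := escape h hρ0 hρ1 M hFM R hR n.factorial (Nat.factorial_pos n)
  -- a neuron silent for a long time is silent until the end of the window
  have fact : ∀ V ∈ M, ∀ L, (∀ t < L, ∀ i, i ∉ A → i ∉ pat θ (F^[t] V)) → ∀ i ∈ A,
      (∀ t < n + T', i ∉ pat θ (F^[t] V)) → ∀ s < L, i ∉ pat θ (F^[s] V) := by
    intro V hV L hL i hi hsil s
    induction s using Nat.strong_induction_on with
    | _ s ihs =>
    intro hsL
    by_cases hs : s < n + T'
    · exact hsil s hs
    have := hT' i (F^[n] V) (hinv V hV n) (s - n) (by omega)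
      (fun k hk => by
        rw [← Function.iterate_add_apply]; exact ihs _ (by omega) (by omega))
      (fun k hk => by
        rw [← Function.iterate_add_apply, ← Function.iterate_add_apply]
        rw [show k + n.factorial + n = (k + n) + n.factorial by omega]
        refine hn i hi V hV s ?_ (k + n) (by omega) (by omega)
        intro t ht j hj
        by_cases hji : j = i
        · subst hji; exact ihs t ht (by omega)
        · exact hL t (by omega) j (fun hjA => hj (Finset.mem_erase.2 ⟨hji, hjA⟩)))
    rwa [← Function.iterate_add_apply, show s - n + n = s by omega] at this
  generalize n + T' = T at fact
  -- one-sided determinism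
  have det1 : ∀ V ∈ M, ∀ L, (∀ t < L, ∀ i, i ∉ A → i ∉ pat θ (F^[t] V)) →
      ∀ a a', a + T < L → a' + T < L →
      (∀ k < T, pat θ (F^[a + k] V) = pat θ (F^[a' + k] V)) →
      pat θ (F^[a + T] V) ⊆ pat θ (F^[a' + T] V) := by
    intro V hV L hL a a' ha ha' hw i hi
    have hiA : i ∈ A := by
      by_contra hiA
      exact hL _ ha i hiA hi
    have hfired : ∃ k < T, i ∈ pat θ (F^[k] (F^[a] V)) := by
      by_contra hcon
      push Not at hcon
      have := fact (F^[a] V) (hinv V hV a) (L - a) (fun t ht j hj => by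
        rw [← Function.iterate_add_apply]; exact hL _ (by omega) j hj) i hiA hcon T (by omega)
      rw [← Function.iterate_add_apply, Nat.add_comm] at this
      exact this hi
    have := fired_determined h (F^[a] V) (F^[a'] V) i T (fun j hj => by
      rw [← Function.iterate_add_apply, ← Function.iterate_add_apply, Nat.add_comm j a,
        Nat.add_comm j a']
      exact hw j hj) hfired
    rw [← Function.iterate_add_apply, ← Function.iterate_add_apply, Nat.add_comm T a,
        Nat.add_comm T a'] at this
    rw [mem_pat] at hi ⊢
    rwa [← this]
  refine ⟨Fintype.card (Fin T → Finset (Fin N)), ?_⟩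
  intro V hV L hL
  generalize hK : Fintype.card (Fin T → Finset (Fin N)) = K
  obtain ⟨x, y, hxy, hwxy⟩ := Fintype.exists_ne_map_eq_of_card_lt
    (fun (a : Fin (K + 1)) (k : Fin T) => pat θ (F^[(a : ℕ) + k] V)) (by simp [← hK])
  obtain ⟨a1, a2, ha, ha2, hw⟩ : ∃ a1 a2 : ℕ, a1 < a2 ∧ a2 ≤ K ∧
      ∀ k < T, pat θ (F^[a1 + k] V) = pat θ (F^[a2 + k] V) := by
    have hne : (x : ℕ) ≠ y := fun h => hxy (Fin.ext h)
    rcases lt_or_gt_of_ne hne with hlt | hlt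
    · exact ⟨x, y, hlt, by omega, fun k hk => congrFun hwxy ⟨k, hk⟩⟩
    · exact ⟨y, x, hlt, by omega, fun k hk => (congrFun hwxy ⟨k, hk⟩).symm⟩
  have key : ∀ j, a2 + j < L → pat θ (F^[a1 + j] V) = pat θ (F^[a2 + j] V) := by
    intro j
    induction j using Nat.strong_induction_on with
    | _ j ihj =>
    intro hj
    by_cases hjT : j < T
    · exact hw j hjT
    have hw' : ∀ k < T, pat θ (F^[a1 + (j - T) + k] V) = pat θ (F^[a2 + (j - T) + k] V) := by
      intro k hk
      rw [Nat.add_assoc, Nat.add_assoc]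
      exact ihj _ (by omega) (by omega)
    have e1 := det1 V hV L hL (a1 + (j - T)) (a2 + (j - T)) (by omega) (by omega) hw'
    have e2 := det1 V hV L hL (a2 + (j - T)) (a1 + (j - T)) (by omega) (by omega)
      (fun k hk => (hw' k hk).symm)
    rw [show a1 + (j - T) + T = a1 + j by omega, show a2 + (j - T) + T = a2 + j by omega] at e1 e2
    exact e1.antisymm e2
  intro t ht htL
  obtain ⟨m, hm⟩ : (a2 - a1) ∣ K.factorial := Nat.dvd_factorial (by omega) (by omega)
  rw [hm] at htL ⊢
  refine iter_period (fun t => pat θ (F^[t] V)) a1 (a2 - a1) L ?_ m t (by omega) htL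
  intro t ht htL
  have := key (t - a1) (by omega)
  rw [show a1 + (t - a1) = t by omega, show a2 + (t - a1) = t + (a2 - a1) by omega] at this
  exact this.symm

theorem main (h : IsNet θ ρ c F) (hρ0 : 0 ≤ ρ) (hρ1 : ρ < 1) (M : Set (Fin N → ℝ))
    (hFM : ∀ V ∈ M, F V ∈ M) (R : ℝ) (hR : ∀ V ∈ M, ∀ i, |V i| ≤ R) :
    (⋂ t : ℕ, F^[t] '' M).Finite ∧
      ∀ V ∈ (⋂ t : ℕ, F^[t] '' M), ∃ p : ℕ, 1 ≤ p ∧ F^[p] V = V := by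
  have hinv : ∀ U ∈ M, ∀ t, F^[t] U ∈ M := by
    intro U hU t
    induction t with
    | zero => exact hU
    | succ t ih => rw [Function.iterate_succ_apply']; exact hFM _ ih
  obtain ⟨n, hn⟩ := per_all h hρ0 hρ1 M hFM R hR Finset.univ
  have hp1 : 1 ≤ n.factorial := Nat.factorial_pos n
  have hper : ∀ V ∈ M, ∀ t, n ≤ t →
      pat θ (F^[t + n.factorial] V) = pat θ (F^[t] V) := fun V hV t ht =>
    hn V hV (t + n.factorial + 1) (fun _ _ i hi => absurd (Finset.mem_univ i) hi) t ht (by omega)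
  generalize n.factorial = p at hp1 hper
  have hfix : ∀ V ∈ (⋂ t : ℕ, F^[t] '' M), F^[p] V = V := by
    intro V hV
    rw [Set.mem_iInter] at hV
    funext i
    have hle : ∀ k : ℕ, |(F^[p] V) i - V i| ≤ ρ ^ k * (2 * R) := by
      intro k
      obtain ⟨y, hy, hyV⟩ := hV (k + n)
      rw [Function.iterate_add_apply] at hyV
      have hc := contraction h hρ0 (F^[p] (F^[n] y)) (F^[n] y) i k (fun j _ => by
        rw [← Function.iterate_add_apply, ← Function.iterate_add_apply,
          ← Function.iterate_add_apply, show j + p + n = j + n + p by omega]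
        exact hper y hy _ (by omega))
      rw [← Function.iterate_add_apply F k p, Nat.add_comm k p, Function.iterate_add_apply F p k,
        hyV] at hc
      refine hc.trans ?_
      gcongr
      have h1 := abs_le.1 (hR _ (hinv _ (hinv y hy n) p) i)
      have h2 := abs_le.1 (hR _ (hinv y hy n) i)
      rw [abs_le]
      constructor <;> linarith [h1.1, h1.2, h2.1, h2.2]
    have htend : Filter.Tendsto (fun n : ℕ => ρ ^ n * (2 * R)) Filter.atTop (nhds 0) := by
      simpa using (tendsto_pow_atTop_nhds_zero_of_lt_one hρ0 hρ1).mul_const (2 * R)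
    have h0 := ge_of_tendsto' htend hle
    exact sub_eq_zero.1 (abs_nonpos_iff.1 h0)
  refine ⟨?_, fun V hV => ⟨p, hp1, hfix V hV⟩⟩
  refine Set.Finite.of_finite_image
    (f := fun V => fun k : Fin p => pat θ (F^[(k : ℕ)] V)) (Set.toFinite _) ?_
  intro V hV V' hV' heq
  funext i
  have hc := contraction h hρ0 V V' i p (fun j hj => congrFun heq ⟨j, hj⟩)
  rw [hfix V hV, hfix V' hV'] at hc
  have hq1 : ρ ^ p < 1 := pow_lt_one₀ hρ0 hρ1 (by omega)
  have h0 : |V i - V' i| ≤ 0 := by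
    by_contra hcon
    push Not at hcon
    nlinarith
  exact sub_eq_zero.1 (abs_nonpos_iff.1 h0)

end

end ModelI

/-- Genericity theorem, item 1: if every orbit in the ω-limit set
`Ω = ⋂ₜ F^[t] '' M` stays at distance at least `δ > 0` from the singularity set
(the firing threshold), then `Ω` is finite and consists of periodic points, i.e.
the asymptotic dynamics is composed of finitely many periodic orbits. -/
theorem modelI_omega_limit_finite_periodic
    (N : ℕ) (hN : 1 ≤ N) (θ ρ : ℝ) (hθ : 0 < θ) (hρ0 : 0 ≤ ρ) (hρ1 : ρ < 1)
    (W : Fin N → Fin N → ℝ) (I : Fin N → ℝ)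
    (Z : ℝ → ℝ) (hZ : ∀ x, Z x = if θ ≤ x then 1 else 0)
    (F : (Fin N → ℝ) → (Fin N → ℝ))
    (hF : ∀ V i, F V i = ρ * V i * (1 - Z (V i)) + (∑ j, W i j * Z (V j)) + I i)
    (M : Set (Fin N → ℝ)) (hMne : M.Nonempty) (hMcpt : IsCompact M)
    (hFM : ∀ V ∈ M, F V ∈ M)
    (Ω : Set (Fin N → ℝ)) (hΩ : Ω = ⋂ t : ℕ, F^[t] '' M)
    (δ : ℝ) (hδ : 0 < δ)
    (hsep : ∀ V ∈ Ω, ∀ t : ℕ, ∀ i, δ ≤ |(F^[t] V) i - θ|) :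
    Ω.Finite ∧ ∀ V ∈ Ω, ∃ p : ℕ, 1 ≤ p ∧ F^[p] V = V := by
  subst hΩ
  obtain ⟨R, hR⟩ := hMcpt.isBounded.exists_norm_le
  refine ModelI.main (θ := θ) (c := fun i S => (∑ j ∈ S, W i j) + I i) ?_ hρ0 hρ1 M hFM R
    (fun V hV i => (norm_le_pi_norm V i).trans (hR V hV))
  intro V i
  have hs : ∑ j, W i j * Z (V j) = ∑ j ∈ ModelI.pat θ V, W i j := by
    simp [ModelI.pat, Finset.sum_filter, hZ]
  rw [hF, hs, hZ]
  simp only [ModelI.mem_pat]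
  split_ifs <;> ring
end

section
/- (Genericity theorem, item 2: raster plots code the asymptotic dynamics.) Let M ⊂ ℝ^N be a nonempty compact set with F(M) ⊆ M for the Model-I map F, let Ω = ⋂_{t ≥ 0} F^t(M), and assume there exists δ > 0 such that for all V ∈ Ω, all t ≥ 0 and all i, |(F^t(V))_i − θ| ≥ δ. Then the raster plot determines the orbit on Ω: if V, V' ∈ Ω and for every t ≥ 0 the iterates F^t(V) and F^t(V') have the same spiking pattern, then V = V'. Hence the symbolic coding of orbits by raster plots is one-to-one on the ω-limit set. -/
/-- The spiking pattern of a state, as a predicate on neurons. -/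
def spikes {ι : Type} (θ : ℝ) (V : ι → ℝ) : ι → Prop := fun j => θ ≤ V j

open Classical in
/-- Abstract form of the network map: leak, reset, and an input depending on the pattern only. -/
def IsNet {ι : Type} (θ ρ : ℝ) (G : (ι → Prop) → ι → ℝ) (F : (ι → ℝ) → (ι → ℝ)) : Prop :=
  ∀ V i, F V i = (if θ ≤ V i then 0 else ρ * V i) + G (spikes θ V) i

/-- Uniform eventual periodicity of rasters as long as neurons outside `S` are silent. -/
def UnifPer {ι : Type} (θ : ℝ) (F : (ι → ℝ) → (ι → ℝ)) (M : Set (ι → ℝ)) (S : Finset ι)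
    (K p : ℕ) : Prop :=
  ∀ V ∈ M, ∀ T : ℕ, (∀ t < T, ∀ i, i ∉ S → ¬ θ ≤ (F^[t] V) i) →
    ∀ t, K ≤ t → t + p < T → spikes θ (F^[t + p] V) = spikes θ (F^[t] V)

theorem per_mul {α : Type} (f : ℕ → α) (K p T : ℕ)
    (h : ∀ t, K ≤ t → t + p < T → f (t + p) = f t) (m : ℕ) :
    ∀ t, K ≤ t → t + m * p < T → f (t + m * p) = f t := by
  induction m with
  | zero => intro t _ _; simp
  | succ m ih =>
    intro t ht hT
    have e : t + (m + 1) * p = t + m * p + p := by ring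
    rw [e] at hT ⊢
    rw [h _ (by omega) hT, ih t ht (by omega)]

/-- Two orbits with the same patterns contract, componentwise. -/
theorem sync_contract {ι : Type} {θ ρ : ℝ} {G : (ι → Prop) → ι → ℝ} {F : (ι → ℝ) → (ι → ℝ)}
    (hF : IsNet θ ρ G F) (hρ0 : 0 ≤ ρ) (U U' : ι → ℝ) (n : ℕ)
    (h : ∀ k < n, spikes θ (F^[k] U) = spikes θ (F^[k] U')) (i : ι) :
    |(F^[n] U) i - (F^[n] U') i| ≤ ρ ^ n * |U i - U' i| ∧
    ((∃ k < n, θ ≤ (F^[k] U) i) → (F^[n] U) i = (F^[n] U') i) := by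
  induction n with
  | zero => simp
  | succ n ih =>
    obtain ⟨h1, h2⟩ := ih (fun k hk => h k (by omega))
    have hn := h n (by omega)
    have hi : (θ ≤ (F^[n] U) i) = (θ ≤ (F^[n] U') i) := congrFun hn i
    rw [Function.iterate_succ_apply', Function.iterate_succ_apply', hF, hF, hn]
    by_cases hc : θ ≤ (F^[n] U) i
    · have hc' : θ ≤ (F^[n] U') i := hi ▸ hc
      simp only [hc, hc', if_true]
      refine ⟨?_, fun _ => by trivial⟩
      simp only [sub_self, abs_zero]
      positivity
    · have hc' : ¬ θ ≤ (F^[n] U') i := hi ▸ hc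
      simp only [hc, hc', if_false]
      constructor
      · rw [add_sub_add_right_eq_sub, ← mul_sub, abs_mul, abs_of_nonneg hρ0, pow_succ]
        nlinarith
      · rintro ⟨k, hk, hk'⟩
        have : k ≠ n := by rintro rfl; exact hc hk'
        rw [h2 ⟨k, by omega, hk'⟩]

/-- Evolution of a silent neuron. -/
theorem silent_evol {ι : Type} {θ ρ : ℝ} {G : (ι → Prop) → ι → ℝ} {F : (ι → ℝ) → (ι → ℝ)}
    (hF : IsNet θ ρ G F) (U : ι → ℝ) (a : ι) (n : ℕ) (h : ∀ k < n, ¬ θ ≤ (F^[k] U) a) :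
    (F^[n] U) a = ρ ^ n * U a
      + ∑ k ∈ Finset.range n, ρ ^ (n - 1 - k) * G (spikes θ (F^[k] U)) a := by
  induction n with
  | zero => simp
  | succ n ih =>
    rw [Function.iterate_succ_apply', hF, if_neg (h n (by omega)),
      ih (fun k hk => h k (by omega)), Finset.sum_range_succ, mul_add, Finset.mul_sum]
    have : ∀ k ∈ Finset.range n, ρ * (ρ ^ (n - 1 - k) * G (spikes θ (F^[k] U)) a)
        = ρ ^ (n + 1 - 1 - k) * G (spikes θ (F^[k] U)) a := by
      intro k hk
      have hk := Finset.mem_range.1 hk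
      have e : n + 1 - 1 - k = (n - 1 - k) + 1 := by omega
      rw [e, pow_succ]; ring
    rw [Finset.sum_congr rfl this]
    simp
    ring

/-- Scalar recursion: if it stayed below threshold long enough it stays below. -/
theorem scalar_stay (l D θ C : ℝ) (hl0 : 0 ≤ l) (u : ℕ → ℝ) (n : ℕ)
    (hn : 2 ≤ n) (hrec : ∀ m < n, u (m + 1) = l * u m + D) (hlt : ∀ m < n, u m < θ)
    (hC : θ - u 0 ≤ C)
    (hgap : 0 < D - (1 - l) * θ → l ^ (n - 1) * C < D - (1 - l) * θ) : u n < θ := by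
  obtain ⟨n, rfl⟩ : ∃ k, n = k + 2 := ⟨n - 2, by omega⟩
  have e1 := hrec n (by omega)
  have e2 := hrec (n + 1) (by omega)
  have l0 := hlt n (by omega)
  have l1 := hlt (n + 1) (by omega)
  rcases lt_trichotomy (D - (1 - l) * θ) 0 with hg | hg | hg
  · show u (n + 1 + 1) < θ
    nlinarith
  · show u (n + 1 + 1) < θ
    have hl : l ≠ 0 := by
      rintro rfl
      linarith
    have : 0 < l := lt_of_le_of_ne hl0 (Ne.symm hl)
    nlinarith
  · exfalso
    have key : ∀ m, m < n + 2 → l ^ (m + 1) * (u 0 - θ) + (D - (1 - l) * θ) ≤ u (m + 1) - θ := by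
      intro m
      induction m with
      | zero => intro _; rw [hrec 0 (by omega)]; simp; linarith
      | succ m ih =>
        intro hm
        have := ih (by omega)
        rw [hrec (m + 1) hm, pow_succ]
        have h3 := mul_le_mul_of_nonneg_left this hl0
        have h4 := mul_nonneg hl0 hg.le
        linarith
    have k1 := key n (by omega)
    have k2 := hgap hg
    have e : n + 2 - 1 = n + 1 := by omega
    rw [e] at k2
    have h5 := mul_le_mul_of_nonneg_left hC (pow_nonneg hl0 (n + 1))
    linarith

theorem iter_mem {α : Type} {F : α → α} {M : Set α} (hM : ∀ V ∈ M, F V ∈ M) (n : ℕ) :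
    ∀ V ∈ M, F^[n] V ∈ M := by
  induction n with
  | zero => intro V h; exact h
  | succ n ih => intro V h; rw [Function.iterate_succ_apply']; exact hM _ (ih V h)

/-- A neuron silent for a (uniformly) long time remains silent. -/
theorem silent_forever {ι : Type} [Finite ι] [DecidableEq ι] {θ ρ : ℝ} {G : (ι → Prop) → ι → ℝ}
    {F : (ι → ℝ) → (ι → ℝ)} (hF : IsNet θ ρ G F) (hρ0 : 0 ≤ ρ) (hρ1 : ρ < 1)
    {M : Set (ι → ℝ)} (hM : ∀ V ∈ M, F V ∈ M) (C : ℝ) (hC : ∀ V ∈ M, ∀ i, |V i| ≤ C)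
    (S : Finset ι) (a : ι) (K p : ℕ) (hp : 0 < p) (hQ : UnifPer θ F M (S.erase a) K p) :
    ∃ L, ∀ V ∈ M, ∀ T, (∀ t < T, ∀ i, i ∉ S → ¬ θ ≤ (F^[t] V) i) →
      (∀ t < L, ¬ θ ≤ (F^[t] V) a) → ∀ t < T, ¬ θ ≤ (F^[t] V) a := by
  let D : (Fin p → ι → Prop) → ℝ := fun w => ∑ k : Fin p, ρ ^ (p - 1 - (k : ℕ)) * G (w k) a
  have hl0 : 0 ≤ ρ ^ p := pow_nonneg hρ0 p
  have hl1 : ρ ^ p < 1 := pow_lt_one₀ hρ0 hρ1 hp.ne'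
  have hev : ∀ᶠ n : ℕ in Filter.atTop, ∀ w, 0 < D w - (1 - ρ ^ p) * θ →
      (ρ ^ p) ^ n * (θ + C) < D w - (1 - ρ ^ p) * θ := by
    rw [Filter.eventually_all]
    intro w
    by_cases hw : 0 < D w - (1 - ρ ^ p) * θ
    · have ht := (tendsto_pow_atTop_nhds_zero_of_lt_one hl0 hl1).mul_const (θ + C)
      rw [zero_mul] at ht
      filter_upwards [ht.eventually (gt_mem_nhds hw)] with n hn _ using hn
    · exact Filter.Eventually.of_forall fun n h => absurd h hw
  obtain ⟨m0, hm0⟩ := Filter.eventually_atTop.1 hev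
  refine ⟨K + (m0 + 2) * p, fun V hV T hS hL t => ?_⟩
  induction t using Nat.strong_induction_on with
  | _ t ih =>
  intro htT
  by_cases htL : t < K + (m0 + 2) * p
  · exact hL t htL
  have hper := hQ V hV t (by
    intro s hs i hi
    by_cases hia : i = a
    · rw [hia]; exact ih s hs (by omega)
    · exact hS s (by omega) i (fun h => hi (Finset.mem_erase.2 ⟨hia, h⟩)))
  obtain ⟨n, r, hr, hn⟩ : ∃ n r, r < p ∧ t = K + r + n * p := by
    refine ⟨(t - K) / p, (t - K) % p, Nat.mod_lt _ hp, ?_⟩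
    have := Nat.mod_add_div (t - K) p
    rw [mul_comm] at this
    omega
  have hnm : m0 + 2 ≤ n := by
    by_contra hlt
    have h1 : (n + 1) * p ≤ (m0 + 2) * p := Nat.mul_le_mul_right p (by omega)
    have h2 : (n + 1) * p = n * p + p := by ring
    omega
  have hmp : ∀ m < n, m * p + p ≤ n * p := by
    intro m hm
    have h1 : (m + 1) * p ≤ n * p := Nat.mul_le_mul_right p (by omega)
    have h2 : (m + 1) * p = m * p + p := by ring
    omega
  have hpm := fun m => per_mul (fun t => spikes θ (F^[t] V)) K p t hper m
  have hlt := scalar_stay (ρ ^ p) (D fun k => spikes θ (F^[K + r + k] V)) θ (θ + C) hl0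
    (fun m => (F^[K + r + m * p] V) a) n (by omega) ?_ ?_ ?_ ?_
  · rw [hn]; exact not_le.2 hlt
  · intro m hm
    have h1 := hmp m hm
    have e : K + r + (m + 1) * p = p + (K + r + m * p) := by ring
    show (F^[K + r + (m + 1) * p] V) a = _
    rw [e, Function.iterate_add_apply, silent_evol hF _ a p, Finset.sum_range]
    · congr 1
      refine Finset.sum_congr rfl fun k _ => ?_
      have hk := k.2
      have e2 : (k : ℕ) + (K + r + m * p) = K + r + k + m * p := by ring
      rw [← Function.iterate_add_apply, e2]
      have := hpm m (K + r + k) (by omega) (by omega)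
      rw [this]
    · intro k hk
      rw [← Function.iterate_add_apply]
      exact ih _ (by omega) (by omega)
  · intro m hm
    have h1 := hmp m hm
    exact not_le.1 (ih _ (by omega) (by omega))
  · have := (abs_le.1 (hC _ (iter_mem hM (K + r + 0 * p) V hV) a)).1
    linarith
  · exact hm0 (n - 1) (by omega) _

theorem unifPer_exists {ι : Type} [Finite ι] [DecidableEq ι] {θ ρ : ℝ} {G : (ι → Prop) → ι → ℝ}
    {F : (ι → ℝ) → (ι → ℝ)} (hF : IsNet θ ρ G F) (hρ0 : 0 ≤ ρ) (hρ1 : ρ < 1)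
    {M : Set (ι → ℝ)} (hM : ∀ V ∈ M, F V ∈ M) (C : ℝ) (hC : ∀ V ∈ M, ∀ i, |V i| ≤ C)
    (S : Finset ι) : ∃ K p, 0 < p ∧ UnifPer θ F M S K p := by
  induction S using Finset.strongInduction with
  | _ S IH =>
  have h1 : ∀ a ∈ S, ∃ K p L, 0 < p ∧ UnifPer θ F M (S.erase a) K p ∧
      ∀ V ∈ M, ∀ T, (∀ t < T, ∀ i, i ∉ S → ¬ θ ≤ (F^[t] V) i) →
      (∀ t < L, ¬ θ ≤ (F^[t] V) a) → ∀ t < T, ¬ θ ≤ (F^[t] V) a := by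
    intro a ha
    obtain ⟨K, p, hp, hQ⟩ := IH _ (Finset.erase_ssubset ha)
    obtain ⟨L, hL⟩ := silent_forever hF hρ0 hρ1 hM C hC S a K p hp hQ
    exact ⟨K, p, L, hp, hQ, hL⟩
  choose! K p L hp hQ hL using h1
  let L' := ∑ a ∈ S, L a
  have hLle : ∀ a ∈ S, L a ≤ L' := fun a ha => Finset.single_le_sum (fun _ _ => Nat.zero_le _) ha
  let K' := ∑ a ∈ S, K a
  have hKle : ∀ a ∈ S, K a ≤ K' := fun a ha => Finset.single_le_sum (fun _ _ => Nat.zero_le _) ha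
  let B := Nat.card (Fin L' → ι → Prop)
  refine ⟨B + L' + K', B.factorial * ∏ a ∈ S, p a,
    Nat.mul_pos (Nat.factorial_pos _) (Finset.prod_pos hp), fun V hV T hS t ht htT => ?_⟩
  by_cases hcase : ∃ s ≤ B, ∃ a ∈ S, ∀ k < L', ¬ θ ≤ (F^[s + k] V) a
  · obtain ⟨s, hs, a, ha, hsil⟩ := hcase
    have hS' : ∀ t < T - s, ∀ i, i ∉ S → ¬ θ ≤ (F^[t] (F^[s] V)) i := by
      intro t ht i hi
      rw [← Function.iterate_add_apply]
      exact hS _ (by omega) i hi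
    have hMs := iter_mem hM s V hV
    have hla := hL a ha _ hMs (T - s) hS' (by
      intro k hk
      have := hLle a ha
      rw [← Function.iterate_add_apply, add_comm]
      exact hsil k (by omega))
    have hper := hQ a ha _ hMs (T - s) (by
      intro k hk i hi
      by_cases hia : i = a
      · rw [hia]; exact hla k hk
      · exact hS' k hk i (fun h => hi (Finset.mem_erase.2 ⟨hia, h⟩)))
    obtain ⟨q, hq⟩ : p a ∣ B.factorial * ∏ a ∈ S, p a :=
      Dvd.dvd.mul_left (Finset.dvd_prod_of_mem p ha) _
    rw [hq, mul_comm] at htT ⊢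
    have hKa := hKle a ha
    have := per_mul (fun t => spikes θ (F^[t] (F^[s] V))) (K a) (p a) (T - s) hper q (t - s)
      (by omega) (by omega)
    simp only [← Function.iterate_add_apply] at this
    rw [show t - s + q * p a + s = t + q * p a by omega, show t - s + s = t by omega] at this
    exact this
  · push Not at hcase
    have hni : ¬ Function.Injective (fun s : Fin (B + 1) =>
        (fun (k : Fin L') => spikes θ (F^[(s : ℕ) + k] V))) := by
      intro hinj
      have := Nat.card_le_card_of_injective _ hinj
      rw [Nat.card_eq_fintype_card, Fintype.card_fin] at this
      omega
    obtain ⟨s, s', hss, hsB, hw⟩ : ∃ s s', s < s' ∧ s' ≤ B ∧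
        ∀ k < L', spikes θ (F^[s + k] V) = spikes θ (F^[s' + k] V) := by
      rw [Function.not_injective_iff] at hni
      obtain ⟨x, y, hxy, hne⟩ := hni
      have hxy' : ∀ k < L', spikes θ (F^[(x : ℕ) + k] V) = spikes θ (F^[(y : ℕ) + k] V) :=
        fun k hk => congrFun hxy ⟨k, hk⟩
      have hx := x.2
      have hy := y.2
      have hne' : (x : ℕ) ≠ y := fun h => hne (Fin.ext h)
      rcases lt_or_gt_of_ne hne' with h | h
      · exact ⟨x, y, h, by omega, hxy'⟩
      · exact ⟨y, x, h, by omega, fun k hk => (hxy' k hk).symm⟩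
    have hagree : ∀ n, s' + n < T → spikes θ (F^[s + n] V) = spikes θ (F^[s' + n] V) := by
      intro n
      induction n using Nat.strong_induction_on with
      | _ n ih =>
      intro hn
      by_cases hnL : n < L'
      · exact hw n hnL
      funext i
      by_cases hi : i ∈ S
      · obtain ⟨k, hk, hk'⟩ := hcase s (by omega) i hi
        have := (sync_contract hF hρ0 (F^[s] V) (F^[s'] V) n (by
          intro k hk
          rw [← Function.iterate_add_apply, ← Function.iterate_add_apply, add_comm k, add_comm k]
          exact ih k hk (by omega)) i).2 ⟨k, by omega, by
            rw [← Function.iterate_add_apply, add_comm k]; exact hk'⟩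
        rw [← Function.iterate_add_apply, ← Function.iterate_add_apply, add_comm n, add_comm n]
          at this
        simp only [spikes]
        rw [this]
      · simp only [spikes, hS (s + n) (by omega) i hi, hS (s' + n) (by omega) i hi]
    have hper : ∀ t, s ≤ t → t + (s' - s) < T →
        spikes θ (F^[t + (s' - s)] V) = spikes θ (F^[t] V) := by
      intro t ht hT
      have := hagree (t - s) (by omega)
      rw [show s + (t - s) = t by omega, show s' + (t - s) = t + (s' - s) by omega] at this
      exact this.symm
    obtain ⟨q, hq⟩ : (s' - s) ∣ B.factorial * ∏ a ∈ S, p a :=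
      Dvd.dvd.mul_right (Nat.dvd_factorial (by omega) (by omega)) _
    rw [hq, mul_comm] at htT ⊢
    exact per_mul (fun t => spikes θ (F^[t] V)) s (s' - s) T hper q t (by omega) htT

/-- Genericity theorem, item 2: under the separation condition from the
singularity set, the raster plot determines the orbit on the ω-limit set: two
points of `Ω` whose orbits display the same spiking pattern at every time are
equal. Hence the symbolic coding of orbits by raster plots is one-to-one on `Ω`. -/
theorem modelI_raster_coding_injective_on_omega_limit
    (N : ℕ) (hN : 1 ≤ N) (θ ρ : ℝ) (hθ : 0 < θ) (hρ0 : 0 ≤ ρ) (hρ1 : ρ < 1)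
    (W : Fin N → Fin N → ℝ) (I : Fin N → ℝ)
    (Z : ℝ → ℝ) (hZ : ∀ x, Z x = if θ ≤ x then 1 else 0)
    (F : (Fin N → ℝ) → (Fin N → ℝ))
    (hF : ∀ V i, F V i = ρ * V i * (1 - Z (V i)) + (∑ j, W i j * Z (V j)) + I i)
    (M : Set (Fin N → ℝ)) (hMne : M.Nonempty) (hMcpt : IsCompact M)
    (hFM : ∀ V ∈ M, F V ∈ M)
    (Ω : Set (Fin N → ℝ)) (hΩ : Ω = ⋂ t : ℕ, F^[t] '' M)
    (δ : ℝ) (hδ : 0 < δ)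
    (hsep : ∀ V ∈ Ω, ∀ t : ℕ, ∀ i, δ ≤ |(F^[t] V) i - θ|) :
    ∀ V ∈ Ω, ∀ V' ∈ Ω,
      (∀ t : ℕ, ∀ i, Z ((F^[t] V) i) = Z ((F^[t] V') i)) → V = V' := by
  classical
  let G : (Fin N → Prop) → Fin N → ℝ := fun P i => (∑ j, W i j * (if P j then 1 else 0)) + I i
  have hNet : IsNet θ ρ G F := by
    intro V i
    have hG : G (spikes θ V) i = (∑ j, W i j * Z (V j)) + I i := by
      show (∑ j, W i j * (if spikes θ V j then (1 : ℝ) else 0)) + I i = _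
      congr 1
      refine Finset.sum_congr rfl fun j _ => ?_
      rw [hZ]
      by_cases h : θ ≤ V j
      · rw [if_pos h, if_pos (show spikes θ V j from h)]
      · rw [if_neg h, if_neg (show ¬ spikes θ V j from h)]
    rw [hG, hF, hZ (V i)]
    by_cases h : θ ≤ V i
    · rw [if_pos h, if_pos h]; ring
    · rw [if_neg h, if_neg h]; ring
  obtain ⟨C, hC⟩ : ∃ C : ℝ, ∀ V ∈ M, ∀ i, |V i| ≤ C := by
    obtain ⟨C, hC⟩ := hMcpt.isBounded.exists_norm_le
    exact ⟨C, fun V hV i => (norm_le_pi_norm V i).trans (hC V hV)⟩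
  obtain ⟨K, p, hp, hQ⟩ := unifPer_exists hNet hρ0 hρ1 hFM C hC Finset.univ
  intro V hV V' hV' hraster
  have hsp : ∀ t, spikes θ (F^[t] V) = spikes θ (F^[t] V') := by
    intro t
    funext i
    have := hraster t i
    rw [hZ, hZ] at this
    simp only [spikes]
    by_cases h1 : θ ≤ (F^[t] V) i <;> by_cases h2 : θ ≤ (F^[t] V') i <;>
      simp only [h1, h2, if_true, if_false] at this ⊢ <;> norm_num at this
  rw [hΩ, Set.mem_iInter] at hV hV'
  have hback : ∀ n, ∀ X ∈ M, ∀ j < n * p,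
      spikes θ (F^[j] (F^[K] X)) = spikes θ (F^[j] (F^[n * p + K] X)) := by
    intro n X hX j hj
    have := per_mul (fun t => spikes θ (F^[t] X)) K p (j + K + n * p + 1)
      (hQ X hX _ (by simp)) n (j + K) (by omega) (by omega)
    rw [← Function.iterate_add_apply, ← Function.iterate_add_apply,
      show j + (n * p + K) = j + K + n * p by omega]
    exact this.symm
  funext i
  have hbound : ∀ n : ℕ, |V i - V' i| ≤ (ρ ^ p) ^ n * (2 * C) := by
    intro n
    obtain ⟨X, hX, hXV⟩ := hV (n * p + K)
    obtain ⟨X', hX', hXV'⟩ := hV' (n * p + K)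
    have h1 := (sync_contract hNet hρ0 (F^[K] X) (F^[K] X') (n * p) (by
      intro j hj
      rw [hback n X hX j hj, hback n X' hX' j hj, hXV, hXV', hsp]) i).1
    rw [← Function.iterate_add_apply, ← Function.iterate_add_apply, hXV, hXV'] at h1
    refine h1.trans ?_
    rw [mul_comm n p, pow_mul]
    refine mul_le_mul_of_nonneg_left ?_ (by positivity)
    have b1 := abs_le.1 (hC _ (iter_mem hFM K X hX) i)
    have b2 := abs_le.1 (hC _ (iter_mem hFM K X' hX') i)
    rw [abs_le]
    constructor <;> linarith
  have ht := (tendsto_pow_atTop_nhds_zero_of_lt_one (pow_nonneg hρ0 p)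
    (pow_lt_one₀ hρ0 hρ1 hp.ne')).mul_const (2 * C)
  rw [zero_mul] at ht
  have h0 := ge_of_tendsto' ht hbound
  exact sub_eq_zero.1 (abs_eq_zero.1 (le_antisymm h0 (abs_nonneg _)))
end
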